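/- arXiv:1901.10818 — 2 statements merged into one kernel-verified Lean document; each statement's English description precedes it below -/
import Mathlib

section
/- Let E⁰, E¹, F⁰, F¹ be finite-dimensional complex inner product spaces, let p : E⁰ → E¹ and q : F⁰ → F¹ be invertible linear maps, and let Ξ⁰ : E⁰ → F⁰ and Ξ¹ : E¹ → F¹ be unitary linear maps satisfying q ∘ Ξ⁰ = Ξ¹ ∘ p. Then for all real numbers a ≥ 0 and b ≥ 0 with (a, b) ≠ (0, 0), the linear map E¹ × F⁰ → E⁰ × F¹ given by (u, v) ↦ (−a·p†(u) + b·(Ξ⁰)†(v), b·Ξ¹(u) + a·q(v)) is bijective. -/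
/-- Given invertible symbols `p : E⁰ → E¹`, `q : F⁰ → F¹` of finite-dimensional complex inner
product spaces and unitary identifications `Ξ⁰ : E⁰ → F⁰`, `Ξ¹ : E¹ → F¹` with `q ∘ Ξ⁰ = Ξ¹ ∘ p`,
the block matrix `[[-a·p†, b·(Ξ⁰)†], [b·Ξ¹, a·q]]` is bijective for all `a, b ≥ 0` not both
zero. -/
theorem stmt_6 {E0 E1 F0 F1 : Type*}
    [NormedAddCommGroup E0] [InnerProductSpace ℂ E0] [FiniteDimensional ℂ E0]
    [NormedAddCommGroup E1] [InnerProductSpace ℂ E1] [FiniteDimensional ℂ E1]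
    [NormedAddCommGroup F0] [InnerProductSpace ℂ F0] [FiniteDimensional ℂ F0]
    [NormedAddCommGroup F1] [InnerProductSpace ℂ F1] [FiniteDimensional ℂ F1]
    (p : E0 →ₗ[ℂ] E1) (hp : Function.Bijective p)
    (q : F0 →ₗ[ℂ] F1) (hq : Function.Bijective q)
    (Ξ0 : E0 →ₗ[ℂ] F0) (Ξ1 : E1 →ₗ[ℂ] F1)
    (hΞ0₁ : LinearMap.adjoint Ξ0 ∘ₗ Ξ0 = LinearMap.id)
    (hΞ0₂ : Ξ0 ∘ₗ LinearMap.adjoint Ξ0 = LinearMap.id)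
    (hΞ1₁ : LinearMap.adjoint Ξ1 ∘ₗ Ξ1 = LinearMap.id)
    (hΞ1₂ : Ξ1 ∘ₗ LinearMap.adjoint Ξ1 = LinearMap.id)
    (hcomm : q ∘ₗ Ξ0 = Ξ1 ∘ₗ p) :
    ∀ a b : ℝ, 0 ≤ a → 0 ≤ b → (a, b) ≠ (0, 0) →
      Function.Bijective (fun uv : E1 × F0 =>
        ((-((a : ℂ) • LinearMap.adjoint p uv.1) + (b : ℂ) • LinearMap.adjoint Ξ0 uv.2,
          (b : ℂ) • Ξ1 uv.1 + (a : ℂ) • q uv.2) : E0 × F1)) := by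
  intro a b _ _ hab
  let T : E1 × F0 →ₗ[ℂ] E0 × F1 :=
    (-((a : ℂ) • (LinearMap.adjoint p ∘ₗ LinearMap.fst ℂ E1 F0)) +
      (b : ℂ) • (LinearMap.adjoint Ξ0 ∘ₗ LinearMap.snd ℂ E1 F0)).prod
    ((b : ℂ) • (Ξ1 ∘ₗ LinearMap.fst ℂ E1 F0) + (a : ℂ) • (q ∘ₗ LinearMap.snd ℂ E1 F0))
  change Function.Bijective T
  have hfin : Module.finrank ℂ (E1 × F0) = Module.finrank ℂ (E0 × F1) := by
    rw [Module.finrank_prod, Module.finrank_prod,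
      (LinearEquiv.ofBijective p hp).finrank_eq, (LinearEquiv.ofBijective q hq).finrank_eq]
  suffices hinj : Function.Injective T from
    ⟨hinj, (LinearMap.injective_iff_surjective_of_finrank_eq_finrank hfin).1 hinj⟩
  rw [injective_iff_map_eq_zero]
  rintro ⟨u, v⟩ h
  obtain ⟨h₁, h₂⟩ := Prod.ext_iff.1 h
  replace h₁ : -((a : ℂ) • LinearMap.adjoint p u) + (b : ℂ) • LinearMap.adjoint Ξ0 v = 0 := h₁
  replace h₂ : (b : ℂ) • Ξ1 u + (a : ℂ) • q v = 0 := h₂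
  obtain ⟨w, rfl⟩ : ∃ w, Ξ0 w = v := ⟨LinearMap.adjoint Ξ0 v, LinearMap.congr_fun hΞ0₂ v⟩
  have hw : LinearMap.adjoint Ξ0 (Ξ0 w) = w := LinearMap.congr_fun hΞ0₁ w
  have hqw : q (Ξ0 w) = Ξ1 (p w) := LinearMap.congr_fun hcomm w
  have hinjΞ1 : Function.Injective Ξ1 :=
    Function.LeftInverse.injective (g := LinearMap.adjoint Ξ1) fun x => LinearMap.congr_fun hΞ1₁ x
  replace h₁ : (a : ℂ) • LinearMap.adjoint p u = (b : ℂ) • w := by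
    rw [hw] at h₁
    exact neg_add_eq_zero.1 h₁
  replace h₂ : (b : ℂ) • u + (a : ℂ) • p w = 0 := by
    apply hinjΞ1
    simpa [hqw] using h₂
  suffices hz : u = 0 ∧ w = 0 by simp [hz.1, hz.2]
  by_cases hb : b = 0
  · have ha : (a : ℂ) ≠ 0 := by
      rintro ha
      exact hab (by simp [hb, Complex.ofReal_eq_zero.1 ha])
    have hpu : LinearMap.adjoint p u = 0 := by simpa [hb, Complex.ofReal_ne_zero.1 ha] using h₁
    have hpw : p w = 0 := by simpa [hb, Complex.ofReal_ne_zero.1 ha] using h₂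
    refine ⟨?_, hp.1 (by simpa using hpw)⟩
    obtain ⟨x, hx⟩ := hp.2 u
    rw [← inner_self_eq_zero (𝕜 := ℂ)]
    nth_rewrite 2 [← hx]
    rw [← LinearMap.adjoint_inner_left, hpu, inner_zero_left]
  · have hbC : (b : ℂ) ≠ 0 := Complex.ofReal_ne_zero.2 hb
    have key : (b : ℂ) * (inner ℂ u u + inner ℂ w w) = 0 := by
      have e₁ := congrArg (fun x => inner ℂ u x) h₂
      have e₂ := congrArg (fun x => inner ℂ x w) h₁
      simp only [inner_add_right, inner_smul_right, inner_smul_left, inner_zero_right,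
        Complex.conj_ofReal, LinearMap.adjoint_inner_left] at e₁ e₂
      rw [mul_add, ← e₂, e₁]
    have hsum := (mul_eq_zero.1 key).resolve_left hbC
    rw [inner_self_eq_norm_sq_to_K, inner_self_eq_norm_sq_to_K] at hsum
    have hR : ‖u‖ ^ 2 + ‖w‖ ^ 2 = 0 := by
      apply Complex.ofReal_injective
      simpa using hsum
    constructor
    · exact norm_eq_zero.1 (by nlinarith [sq_nonneg ‖u‖, sq_nonneg ‖w‖])
    · exact norm_eq_zero.1 (by nlinarith [sq_nonneg ‖u‖, sq_nonneg ‖w‖])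
end

section
/- Let K be a field and let 0 → U →ⁱ V →ᵖ W → 0 be a short exact sequence of finite-dimensional K-vector spaces (i injective, p surjective, range i = ker p). Set a := finrank U and b := finrank W, so finrank V = a + b. Let u₀ be a nonzero element of the a-th exterior power ⋀ᵃU. Then the linear map ⋀ᵇV → ⋀^{a+b}V given by v ↦ (⋀ᵃi)(u₀) ∧ v (exterior multiplication by the image of u₀ under the map induced by i on exterior powers) is surjective, and its kernel equals the kernel of the induced map ⋀ᵇp : ⋀ᵇV → ⋀ᵇW. -/
open Module

/-- The wedge product of a basis is nonzero. -/
theorem Module.Basis.exteriorAlgebra_ιMulti_ne_zero {K M : Type*} [Field K] [AddCommGroup M]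
    [Module K M] {n : ℕ} (e : Basis (Fin n) K M) : ExteriorAlgebra.ιMulti K n e ≠ 0 := by
  intro h
  have h0 : exteriorPower.ιMulti K n e = 0 := Subtype.ext h
  have h1 := exteriorPower.alternatingMapLinearEquiv_apply_ιMulti e.det e
  rw [h0, map_zero, e.det_self] at h1
  exact zero_ne_one h1

namespace ExteriorAlgebra

theorem map_mem_exteriorPower {R M N : Type*} [CommRing R] [AddCommGroup M] [Module R M]
    [AddCommGroup N] [Module R N] (f : M →ₗ[R] N) {n : ℕ} {x : ExteriorAlgebra R M}
    (hx : x ∈ ⋀[R]^n M) : map f x ∈ ⋀[R]^n N := by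
  rw [← ιMulti_span_fixedDegree] at hx
  induction hx using Submodule.span_induction with
  | mem x hx =>
    obtain ⟨v, rfl⟩ := hx
    rw [map_apply_ιMulti]
    exact (exteriorPower.ιMulti R n _).2
  | zero => simp
  | add x y _ _ hx hy => rw [map_add]; exact add_mem hx hy
  | smul c x _ hx => rw [map_smul]; exact Submodule.smul_mem _ c hx

/-- If `q` differs from the identity only by vectors killed by right multiplication on `ω`, then
`ω ∧ x = ω ∧ q_*(x)` for all `x`. -/
theorem mul_map_eq_mul {R M : Type*} [CommRing R] [AddCommGroup M] [Module R M]
    (N : Submodule R M) (q : M →ₗ[R] M) (hq : ∀ v, v - q v ∈ N)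
    (ω : ExteriorAlgebra R M) (hω : ∀ u ∈ N, ω * ι R u = 0) (x : ExteriorAlgebra R M) :
    ω * map q x = ω * x := by
  suffices H : ∀ ω : ExteriorAlgebra R M, (∀ u ∈ N, ω * ι R u = 0) →
      (∀ u ∈ N, ω * x * ι R u = 0) ∧ ω * map q x = ω * x from (H ω hω).2
  induction x using ExteriorAlgebra.induction with
  | algebraMap r =>
    refine fun ω hω ↦ ⟨fun u hu ↦ ?_, by simp⟩
    rw [← Algebra.commutes, mul_assoc, hω u hu, mul_zero]
  | ι v =>
    refine fun ω hω ↦ ⟨fun u hu ↦ ?_, ?_⟩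
    · rw [mul_assoc, eq_neg_of_add_eq_zero_left (ι_add_mul_swap v u), mul_neg, ← mul_assoc,
        hω u hu, zero_mul, neg_zero]
    · have h := hω _ (hq v)
      rw [map_sub, mul_sub, sub_eq_zero] at h
      rw [map_apply_ι, h]
  | mul x y hx hy =>
    intro ω hω
    obtain ⟨hx1, hx2⟩ := hx ω hω
    obtain ⟨hy1, hy2⟩ := hy _ hx1
    refine ⟨by simpa only [mul_assoc] using hy1, ?_⟩
    rw [map_mul, ← mul_assoc, hx2, hy2, mul_assoc]
  | add x y hx hy =>
    intro ω hω
    obtain ⟨hx1, hx2⟩ := hx ω hω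
    obtain ⟨hy1, hy2⟩ := hy ω hω
    refine ⟨fun u hu ↦ ?_, by rw [map_add, mul_add, mul_add, hx2, hy2]⟩
    rw [mul_add, add_mul, hx1 u hu, hy1 u hu, add_zero]

end ExteriorAlgebra


/-- Given a short exact sequence `0 → U → V → W → 0` of finite-dimensional `K`-vector spaces
with `a = dim U`, `b = dim W`, and a nonzero `u₀ ∈ ⋀ᵃU`, the map `⋀ᵇV → ⋀^{a+b}V`,
`v ↦ i_*(u₀) ∧ v`, is surjective with kernel equal to the kernel of `⋀ᵇp : ⋀ᵇV → ⋀ᵇW`. -/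
theorem stmt_14 {K U V W : Type*} [Field K]
    [AddCommGroup U] [Module K U] [FiniteDimensional K U]
    [AddCommGroup V] [Module K V] [FiniteDimensional K V]
    [AddCommGroup W] [Module K W] [FiniteDimensional K W]
    (i : U →ₗ[K] V) (p : V →ₗ[K] W)
    (hi : Function.Injective i) (hp : Function.Surjective p)
    (hexact : LinearMap.range i = LinearMap.ker p)
    (a b : ℕ) (ha : a = Module.finrank K U) (hb : b = Module.finrank K W)
    (u₀ : ⋀[K]^a U) (hu₀ : u₀ ≠ 0) :
    Module.finrank K V = a + b ∧
    LinearMap.range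
        ((LinearMap.mulLeft K
            (ExteriorAlgebra.map i (u₀ : ExteriorAlgebra K U))).comp
          (Submodule.subtype (⋀[K]^b V))) = ⋀[K]^(a + b) V ∧
    LinearMap.ker
        ((LinearMap.mulLeft K
            (ExteriorAlgebra.map i (u₀ : ExteriorAlgebra K U))).comp
          (Submodule.subtype (⋀[K]^b V))) =
      LinearMap.ker
        ((ExteriorAlgebra.map p).toLinearMap.comp (Submodule.subtype (⋀[K]^b V))) := by
  obtain ⟨s, hs⟩ := p.exists_rightInverse_of_surjective (LinearMap.range_eq_top.2 hp)
  have hps : ∀ w, p (s w) = w := LinearMap.congr_fun hs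
  have hpi : ∀ u, p (i u) = 0 := fun u ↦ hexact.le (LinearMap.mem_range_self i u)
  have hbij : Function.Bijective (i.coprod s) := by
    refine ⟨(injective_iff_map_eq_zero _).2 fun ⟨u, w⟩ h ↦ ?_, fun v ↦ ?_⟩
    · rw [LinearMap.coprod_apply] at h
      have hw : w = 0 := by simpa [hpi, hps] using congrArg p h
      subst hw
      have hu : u = 0 := hi (by simpa using h)
      rw [hu, Prod.mk_zero_zero]
    · obtain ⟨u, hu⟩ : v - s (p v) ∈ LinearMap.range i := by
        rw [hexact, LinearMap.mem_ker, map_sub, hps, sub_self]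
      exact ⟨(u, p v), by simp [hu]⟩
  let E := LinearEquiv.ofBijective _ hbij
  have hV : finrank K V = a + b := by rw [← E.finrank_eq, finrank_prod, ha, hb]
  let e : Basis (Fin a) K U := finBasisOfFinrankEq K U ha.symm
  let f : Basis (Fin b) K W := finBasisOfFinrankEq K W hb.symm
  let B : Basis (Fin (a + b)) K V := ((e.prod f).map E).reindex finSumFinEquiv
  have hB : ⇑B = Fin.append (i ∘ e) (s ∘ f) := by
    ext j
    induction j using Fin.addCases <;> simp [B, E]
  set ω := ExteriorAlgebra.map i (u₀ : ExteriorAlgebra K U) with hωdef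
  set L := (LinearMap.mulLeft K ω).comp (Submodule.subtype (⋀[K]^b V))
  set P := (ExteriorAlgebra.map p).toLinearMap.comp (Submodule.subtype (⋀[K]^b V))
  have hω : ω ∈ ⋀[K]^a V := ExteriorAlgebra.map_mem_exteriorPower i u₀.2
  have hLle : LinearMap.range L ≤ ⋀[K]^(a + b) V := by
    rintro _ ⟨x, rfl⟩
    exact SetLike.mul_mem_graded hω x.2
  have hL0 : L ≠ 0 := by
    intro h
    have hU1 : finrank K (⋀[K]^a U) = 1 := by rw [exteriorPower.finrank_eq, ← ha, Nat.choose_self]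
    obtain ⟨c, hc⟩ := (finrank_eq_one_iff_of_nonzero' u₀ hu₀).1 hU1 (exteriorPower.ιMulti K a e)
    have hc' : c • (u₀ : ExteriorAlgebra K U) = ExteriorAlgebra.ιMulti K a e :=
      congrArg Subtype.val hc
    apply B.exteriorAlgebra_ιMulti_ne_zero
    rw [hB, ← ExteriorAlgebra.ιMulti_mul_ιMulti, ← ExteriorAlgebra.map_apply_ιMulti, ← hc',
      map_smul, smul_mul_assoc]
    have := LinearMap.congr_fun h (exteriorPower.ιMulti K b (s ∘ f))
    replace this : ω * ExteriorAlgebra.ιMulti K b (s ∘ f) = 0 := this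
    rw [this, smul_zero]
  have hV1 : finrank K (⋀[K]^(a + b) V) = 1 := by
    rw [exteriorPower.finrank_eq, hV, Nat.choose_self]
  have hLpos : 1 ≤ finrank K (LinearMap.range L) :=
    Submodule.one_le_finrank_iff.2 (mt LinearMap.range_eq_bot.1 hL0)
  have hω0 : ∀ v ∈ LinearMap.range i, ω * ExteriorAlgebra.ι K v = 0 := by
    rintro _ ⟨u, rfl⟩
    have hU : finrank K (⋀[K]^(a + 1) U) = 0 := by
      rw [exteriorPower.finrank_eq, ← ha, Nat.choose_succ_self]
    have hmem : (u₀ : ExteriorAlgebra K U) * ExteriorAlgebra.ι K u ∈ ⋀[K]^(a + 1) U :=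
      SetLike.mul_mem_graded u₀.2 (by simp)
    rw [Submodule.finrank_eq_zero.1 hU, Submodule.mem_bot] at hmem
    rw [hωdef, ← ExteriorAlgebra.map_apply_ι, ← map_mul, hmem, map_zero]
  have hker : LinearMap.ker P ≤ LinearMap.ker L := by
    intro x hx
    replace hx : ExteriorAlgebra.map p (x : ExteriorAlgebra K V) = 0 := hx
    have h := ExteriorAlgebra.mul_map_eq_mul (LinearMap.range i) (s ∘ₗ p)
      (fun v ↦ by simp [hexact, hps]) ω hω0 x
    rw [← ExteriorAlgebra.map_comp_map, AlgHom.comp_apply, hx, map_zero, mul_zero] at h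
    exact h.symm
  have hP1 : finrank K (LinearMap.range P) ≤ 1 := by
    have hle : LinearMap.range P ≤ ⋀[K]^b W := by
      rintro _ ⟨x, rfl⟩
      exact ExteriorAlgebra.map_mem_exteriorPower p x.2
    refine (Submodule.finrank_mono hle).trans ?_
    rw [exteriorPower.finrank_eq, ← hb, Nat.choose_self]
  refine ⟨hV, Submodule.eq_of_le_of_finrank_le hLle (hV1.trans_le hLpos), ?_⟩
  refine (Submodule.eq_of_le_of_finrank_le hker ?_).symm
  have h1 := L.finrank_range_add_finrank_ker
  have h2 := P.finrank_range_add_finrank_ker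
  omega
end
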